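/- arXiv:2111.15008 — 7 statements merged into one kernel-verified Lean document; each statement's English description precedes it below -/
import Mathlib

section
/- Let M > 0 be a real number. For any five pairs of real numbers (x_i, y_i), i = 1,…,5, with (x_1, y_1) = (0, 0) and |x_i| ≤ M/2 and |y_i| ≤ M/2 for all i, one has M² · Σ_i (x_i² + y_i²) ≥ 2 · ((Σ_i x_i²)(Σ_i y_i²) − (Σ_i x_i y_i)²). Moreover, equality holds when the five points are (0,0), (M/2, M/2), (−M/2, M/2), (M/2, −M/2), (−M/2, −M/2). -/
/-- If the first of `n + 1` real numbers vanishes and all have absolute value at most `r`, then their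
squares sum to at most `n * r ^ 2`. -/
theorem sum_sq_le_of_zero_eq_zero {n : ℕ} {r : ℝ} {x : Fin (n + 1) → ℝ} (h0 : x 0 = 0)
    (hx : ∀ i, |x i| ≤ r) : ∑ i, x i ^ 2 ≤ n * r ^ 2 := by
  have hsq (i : Fin n) : x i.succ ^ 2 ≤ r ^ 2 := sq_le_sq.2 ((hx _).trans (le_abs_self r))
  simpa [Fin.sum_univ_succ, h0] using Finset.sum_le_sum fun i (_ : i ∈ Finset.univ) => hsq i


theorem stmt_0 (M : ℝ) (hM : 0 < M) :
    (∀ x y : Fin 5 → ℝ, x 0 = 0 → y 0 = 0 →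
      (∀ i, |x i| ≤ M / 2) → (∀ i, |y i| ≤ M / 2) →
      M ^ 2 * (∑ i, (x i ^ 2 + y i ^ 2)) ≥
        2 * ((∑ i, x i ^ 2) * (∑ i, y i ^ 2) - (∑ i, x i * y i) ^ 2)) ∧
    (M ^ 2 * (∑ i, ((![0, M / 2, -(M / 2), M / 2, -(M / 2)] : Fin 5 → ℝ) i ^ 2 +
        (![0, M / 2, M / 2, -(M / 2), -(M / 2)] : Fin 5 → ℝ) i ^ 2)) =
      2 * ((∑ i, (![0, M / 2, -(M / 2), M / 2, -(M / 2)] : Fin 5 → ℝ) i ^ 2) *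
            (∑ i, (![0, M / 2, M / 2, -(M / 2), -(M / 2)] : Fin 5 → ℝ) i ^ 2) -
          (∑ i, (![0, M / 2, -(M / 2), M / 2, -(M / 2)] : Fin 5 → ℝ) i *
            (![0, M / 2, M / 2, -(M / 2), -(M / 2)] : Fin 5 → ℝ) i) ^ 2)) := by
  refine ⟨fun x y hx0 hy0 hx hy => ?_, ?_⟩
  · have hA : ∑ i, x i ^ 2 ≤ M ^ 2 :=
      (sum_sq_le_of_zero_eq_zero hx0 hx).trans_eq (by push_cast; ring)
    have hB : ∑ i, y i ^ 2 ≤ M ^ 2 :=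
      (sum_sq_le_of_zero_eq_zero hy0 hy).trans_eq (by push_cast; ring)
    have hA0 : 0 ≤ ∑ i, x i ^ 2 := Finset.sum_nonneg fun i _ => sq_nonneg (x i)
    have hB0 : 0 ≤ ∑ i, y i ^ 2 := Finset.sum_nonneg fun i _ => sq_nonneg (y i)
    rw [Finset.sum_add_distrib]
    linarith [mul_le_mul_of_nonneg_left hB hA0, mul_le_mul_of_nonneg_right hA hB0,
      sq_nonneg (∑ i, x i * y i)]
  · simp [Fin.sum_univ_succ]
    ring
end

section
/- Let M > 0 be a real number. Let (x_i, y_i), i = 1,…,5, be pairs of real numbers with (x_1, y_1) = (0, 0), |x_i| ≤ M/2 and |y_i| ≤ M/2 for all i, satisfying (Σ_i x_i²)(Σ_i y_i²) > (Σ_i x_i y_i)². If moreover Σ_i x_i² < M² or Σ_i y_i² < M², then (Σ_i (x_i² + y_i²)) / ((Σ_i x_i²)(Σ_i y_i²) − (Σ_i x_i y_i)²) > 2/M²; that is, the cost U is strictly larger than 2/M². -/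
theorem sum_sq_le_of_zero (M : ℝ) (x : Fin 5 → ℝ) (hx0 : x 0 = 0)
    (hx : ∀ i, |x i| ≤ M / 2) : ∑ i, x i ^ 2 ≤ M ^ 2 := by
  have h : ∀ i, x i ^ 2 ≤ (M / 2) ^ 2 := fun i => sq_le_sq.2 ((hx i).trans (le_abs_self _))
  rw [Fin.sum_univ_five, hx0]
  linarith [h 1, h 2, h 3, h 4]

theorem stmt_1 (M : ℝ) (hM : 0 < M) (x y : Fin 5 → ℝ)
    (hx0 : x 0 = 0) (hy0 : y 0 = 0)
    (hx : ∀ i, |x i| ≤ M / 2) (hy : ∀ i, |y i| ≤ M / 2)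
    (hden : (∑ i, x i ^ 2) * (∑ i, y i ^ 2) > (∑ i, x i * y i) ^ 2)
    (hlt : (∑ i, x i ^ 2) < M ^ 2 ∨ (∑ i, y i ^ 2) < M ^ 2) :
    (∑ i, (x i ^ 2 + y i ^ 2)) /
      ((∑ i, x i ^ 2) * (∑ i, y i ^ 2) - (∑ i, x i * y i) ^ 2) > 2 / M ^ 2 := by
  have hA := sum_sq_le_of_zero M x hx0 hx
  have hB := sum_sq_le_of_zero M y hy0 hy
  have hA0 : 0 ≤ ∑ i, x i ^ 2 := Finset.sum_nonneg fun i _ => sq_nonneg _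
  have hB0 : 0 ≤ ∑ i, y i ^ 2 := Finset.sum_nonneg fun i _ => sq_nonneg _
  rw [Finset.sum_add_distrib]
  generalize ∑ i, x i ^ 2 = A at *
  generalize ∑ i, y i ^ 2 = B at *
  generalize ∑ i, x i * y i = C at *
  have hAB : 0 < A * B := (sq_nonneg C).trans_lt hden
  have hApos : 0 < A := pos_of_mul_pos_left hAB hB0
  have hBpos : 0 < B := pos_of_mul_pos_right hAB hA0
  rw [gt_iff_lt, div_lt_div_iff₀ (by positivity) (sub_pos.2 hden)]
  have h1 : 0 ≤ B * (M ^ 2 - A) := mul_nonneg hB0 (sub_nonneg.2 hA)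
  have h2 : 0 ≤ A * (M ^ 2 - B) := mul_nonneg hA0 (sub_nonneg.2 hB)
  rcases hlt with h | h
  · linarith [mul_pos hBpos (sub_pos.2 h), sq_nonneg C]
  · linarith [mul_pos hApos (sub_pos.2 h), sq_nonneg C]
end

section
/- Let M ≥ 4 be an even integer and set s = 2M² + 4(M/2 − 1)². For any 13 pairwise distinct integer points (x_i, y_i), i = 1,…,13, with −M/2 ≤ x_i ≤ M/2 and −M/2 ≤ y_i ≤ M/2 and with (0,0) among them, one has s · Σ_i (x_i² + y_i²) ≥ 2 · ((Σ_i x_i²)(Σ_i y_i²) − (Σ_i x_i y_i)²). Moreover, equality holds for the configuration consisting of (0,0), the four corner points (±M/2, ±M/2), and the eight points (±(M/2 − 1), ±M/2) and (±M/2, ±(M/2 − 1)). -/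
/-- In the square of half-side `h`, a lattice point other than a corner has squared norm at most
`h ^ 2 + (h - 1) ^ 2`. -/
lemma sq_add_sq_le_of_not_corner {h x y : ℤ} (hx : |x| ≤ h) (hy : |y| ≤ h)
    (hxy : ¬(|x| = h ∧ |y| = h)) : x ^ 2 + y ^ 2 ≤ h ^ 2 + (h - 1) ^ 2 := by
  rw [← sq_abs x, ← sq_abs y]
  have hx₀ := abs_nonneg x
  have hy₀ := abs_nonneg y
  rcases hx.lt_or_eq with hlt | heq
  · have : |x| ≤ h - 1 := by lia
    nlinarith
  · have : |y| ≤ h - 1 := by grind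
    nlinarith

/-- Distinct lattice points in the square of half-side `h`, one of which is the origin, have total
squared norm at most that of the four corners together with non-corner points of largest norm. -/
lemma sum_sq_add_sq_le {ι : Type*} [Fintype ι] {h : ℤ} (hh : 1 ≤ h) {p : ι → ℤ × ℤ}
    (hp : Function.Injective p) (hbox : ∀ i, |(p i).1| ≤ h ∧ |(p i).2| ≤ h) {i₀ : ι}
    (hi₀ : p i₀ = (0, 0)) :
    ∑ i, ((p i).1 ^ 2 + (p i).2 ^ 2) ≤
      (Fintype.card ι - 1) * (h ^ 2 + (h - 1) ^ 2) + 4 * (2 * h - 1) := by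
  classical
  let corners : Finset (ℤ × ℤ) := {h, -h} ×ˢ {h, -h}
  have hcorner (i : ι) : p i ∈ corners ↔ |(p i).1| = h ∧ |(p i).2| = h := by
    simp [corners, abs_eq (by lia : 0 ≤ h)]
  have hcard : (Finset.univ.filter fun i => p i ∈ corners).card ≤ 4 :=
    calc _ ≤ corners.card :=
          Finset.card_le_card_of_injOn p (fun i hi => by simpa using hi) hp.injOn
      _ ≤ 2 * 2 := by
          rw [Finset.card_product]
          exact Nat.mul_le_mul Finset.card_le_two Finset.card_le_two
  have hcard' : ((Finset.univ.filter fun i => p i ∈ corners).card : ℤ) ≤ 4 := by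
    exact_mod_cast hcard
  have hpoint (i : ι) : (p i).1 ^ 2 + (p i).2 ^ 2 ≤ (h ^ 2 + (h - 1) ^ 2)
      + (if p i ∈ corners then 2 * h - 1 else 0)
      - (if i = i₀ then h ^ 2 + (h - 1) ^ 2 else 0) := by
    by_cases hi : i = i₀
    · subst hi
      rw [if_pos rfl, hi₀]
      split_ifs <;> norm_num
      lia
    · rw [if_neg hi]
      split_ifs with hc
      · rw [hcorner] at hc
        rw [← sq_abs (p i).1, ← sq_abs (p i).2, hc.1, hc.2]
        linarith
      · rw [hcorner] at hc
        linarith [sq_add_sq_le_of_not_corner (hbox i).1 (hbox i).2 hc]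
  refine (Finset.sum_le_sum fun i _ => hpoint i).trans ?_
  rw [Finset.sum_sub_distrib, Finset.sum_add_distrib, ← Finset.sum_filter]
  simp only [Finset.sum_const, Finset.sum_ite_eq', Finset.mem_univ, if_true, nsmul_eq_mul,
    Finset.card_univ]
  nlinarith


theorem stmt_3 (M : ℤ) (hM : 4 ≤ M) (hMeven : Even M) :
    (∀ p : Fin 13 → ℤ × ℤ, Function.Injective p →
      (∀ i, -(M / 2) ≤ (p i).1 ∧ (p i).1 ≤ M / 2 ∧ -(M / 2) ≤ (p i).2 ∧ (p i).2 ≤ M / 2) →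
      (∃ i, p i = (0, 0)) →
      (2 * M ^ 2 + 4 * (M / 2 - 1) ^ 2) * (∑ i, ((p i).1 ^ 2 + (p i).2 ^ 2)) ≥
        2 * ((∑ i, (p i).1 ^ 2) * (∑ i, (p i).2 ^ 2) - (∑ i, (p i).1 * (p i).2) ^ 2)) ∧
    (∀ p : Fin 13 → ℤ × ℤ,
      p = ![(0, 0), (M / 2, M / 2), (-(M / 2), M / 2), (M / 2, -(M / 2)), (-(M / 2), -(M / 2)),
        (M / 2 - 1, M / 2), (-(M / 2 - 1), M / 2), (M / 2 - 1, -(M / 2)), (-(M / 2 - 1), -(M / 2)),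
        (M / 2, M / 2 - 1), (-(M / 2), M / 2 - 1), (M / 2, -(M / 2 - 1)), (-(M / 2), -(M / 2 - 1))] →
      (2 * M ^ 2 + 4 * (M / 2 - 1) ^ 2) * (∑ i, ((p i).1 ^ 2 + (p i).2 ^ 2)) =
        2 * ((∑ i, (p i).1 ^ 2) * (∑ i, (p i).2 ^ 2) - (∑ i, (p i).1 * (p i).2) ^ 2)) := by
  obtain ⟨h, rfl⟩ := hMeven
  have hhalf : (h + h) / 2 = h := by lia
  rw [hhalf]
  refine ⟨fun p hp hbox ⟨i₀, hi₀⟩ => ?_, ?_⟩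
  · have hsum := sum_sq_add_sq_le (by lia : 1 ≤ h) hp
      (fun i => by simp only [abs_le]; grind) hi₀
    have hnonneg : 0 ≤ ∑ i, ((p i).1 ^ 2 + (p i).2 ^ 2) :=
      Finset.sum_nonneg fun i _ => by positivity
    simp only [Fintype.card_fin] at hsum
    push_cast at hsum
    rw [Finset.sum_add_distrib] at hsum hnonneg ⊢
    set A := ∑ i, (p i).1 ^ 2
    set B := ∑ i, (p i).2 ^ 2
    set C := ∑ i, (p i).1 * (p i).2
    have hle : A + B ≤ 2 * (2 * (h + h) ^ 2 + 4 * (h - 1) ^ 2) := by linarith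
    linarith [mul_le_mul_of_nonneg_right hle hnonneg, sq_nonneg (A - B), sq_nonneg C]
  · rintro p rfl
    simp [Fin.sum_univ_succ]
    ring
end

section
/- Let M > 0 and let x₁, y₁, x₂, y₂ be real numbers with 2(x₁² + x₂²) ≤ M². Then for every real number α, M² · ((x₁ + α·y₁)² + (x₂ + α·y₂)²) ≥ 2·α² · (x₁·y₂ − x₂·y₁)². -/
theorem stmt_6 (M x₁ y₁ x₂ y₂ : ℝ) (hM : 0 < M)
    (hx : 2 * (x₁ ^ 2 + x₂ ^ 2) ≤ M ^ 2) (α : ℝ) :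
    M ^ 2 * ((x₁ + α * y₁) ^ 2 + (x₂ + α * y₂) ^ 2) ≥
      2 * α ^ 2 * (x₁ * y₂ - x₂ * y₁) ^ 2 := by
  have h : 2 * (x₁ ^ 2 + x₂ ^ 2) * ((x₁ + α * y₁) ^ 2 + (x₂ + α * y₂) ^ 2) ≤
      M ^ 2 * ((x₁ + α * y₁) ^ 2 + (x₂ + α * y₂) ^ 2) :=
    mul_le_mul_of_nonneg_right hx (by positivity)
  linarith [sq_nonneg (x₁ * (x₁ + α * y₁) + x₂ * (x₂ + α * y₂))]
end

section
/- Let M > 0 and let α be a real number with 0 ≤ α < 1. Consider Q_α(x₁, y₁, x₂, y₂) = ((x₁ + α·y₁)² + (x₂ + α·y₂)²)/(x₁·y₂ − x₂·y₁)² on the domain of quadruples (x₁, y₁, x₂, y₂) with all coordinates in [−M/2, M/2] and x₁·y₂ ≠ x₂·y₁. Then 2/M² is the least value of Q_α on this domain, attained at (x₁, y₁, x₂, y₂) = (−M/2, M/2, M(1 − 2α)/2, M/2). -/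
theorem stmt_8 (M α : ℝ) (hM : 0 < M) (hα0 : 0 ≤ α) (hα1 : α < 1) :
    IsLeast {q : ℝ | ∃ x₁ y₁ x₂ y₂ : ℝ,
        x₁ ∈ Set.Icc (-(M / 2)) (M / 2) ∧ y₁ ∈ Set.Icc (-(M / 2)) (M / 2) ∧
        x₂ ∈ Set.Icc (-(M / 2)) (M / 2) ∧ y₂ ∈ Set.Icc (-(M / 2)) (M / 2) ∧
        x₁ * y₂ ≠ x₂ * y₁ ∧
        q = ((x₁ + α * y₁) ^ 2 + (x₂ + α * y₂) ^ 2) / (x₁ * y₂ - x₂ * y₁) ^ 2}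
      (2 / M ^ 2) ∧
    ((-(M / 2) + α * (M / 2)) ^ 2 + (M * (1 - 2 * α) / 2 + α * (M / 2)) ^ 2) /
        (-(M / 2) * (M / 2) - M * (1 - 2 * α) / 2 * (M / 2)) ^ 2 = 2 / M ^ 2 := by
  have hα : 1 - α ≠ 0 := by linarith
  have attained : ((-(M / 2) + α * (M / 2)) ^ 2 + (M * (1 - 2 * α) / 2 + α * (M / 2)) ^ 2) /
      (-(M / 2) * (M / 2) - M * (1 - 2 * α) / 2 * (M / 2)) ^ 2 = 2 / M ^ 2 := by
    have hdet : -(M / 2) * (M / 2) - M * (1 - 2 * α) / 2 * (M / 2) = -(M ^ 2 * (1 - α) / 2) := by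
      ring
    rw [hdet]
    field_simp
    ring
  refine ⟨⟨⟨-(M / 2), M / 2, M * (1 - 2 * α) / 2, M / 2, ⟨le_rfl, by linarith⟩,
    ⟨by linarith, le_rfl⟩, ⟨by nlinarith, by nlinarith⟩, ⟨by linarith, le_rfl⟩,
    by nlinarith [mul_pos (mul_pos hM hM) (sub_pos.2 hα1)], attained.symm⟩, ?_⟩, attained⟩
  rintro q ⟨x₁, y₁, x₂, y₂, -, hy₁, -, hy₂, hne, rfl⟩
  have hdet : 0 < (x₁ * y₂ - x₂ * y₁) ^ 2 := sq_pos_of_ne_zero (sub_ne_zero.2 hne)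
  rw [div_le_div_iff₀ (by positivity) hdet]
  have h₁ : y₁ ^ 2 ≤ (M / 2) ^ 2 := sq_le_sq' hy₁.1 hy₁.2
  have h₂ : y₂ ^ 2 ≤ (M / 2) ^ 2 := sq_le_sq' hy₂.1 hy₂.2
  have cauchy_schwarz : (x₁ * y₂ - x₂ * y₁) ^ 2 ≤
      ((x₁ + α * y₁) ^ 2 + (x₂ + α * y₂) ^ 2) * (y₁ ^ 2 + y₂ ^ 2) := by
    linarith [sq_nonneg ((x₁ + α * y₁) * y₁ + (x₂ + α * y₂) * y₂)]
  have hy : y₁ ^ 2 + y₂ ^ 2 ≤ M ^ 2 / 2 := by linarith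
  have hle := mul_le_mul_of_nonneg_left hy
    (by positivity : 0 ≤ (x₁ + α * y₁) ^ 2 + (x₂ + α * y₂) ^ 2)
  linarith
end

section
/- Let M > 0 and let α be a real number with α > 1. Consider Q_α(x₁, y₁, x₂, y₂) = ((x₁ + α·y₁)² + (x₂ + α·y₂)²)/(x₁·y₂ − x₂·y₁)² on the domain of quadruples (x₁, y₁, x₂, y₂) with all coordinates in [−M/2, M/2] and x₁·y₂ ≠ x₂·y₁. Then 2α²/M² is the least value of Q_α on this domain, attained at (x₁, y₁, x₂, y₂) = (−M/2, M/2, −M/2, M(2 − α)/(2α)). -/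
theorem stmt_9 (M α : ℝ) (hM : 0 < M) (hα : 1 < α) :
    IsLeast {q : ℝ | ∃ x₁ y₁ x₂ y₂ : ℝ,
        x₁ ∈ Set.Icc (-(M / 2)) (M / 2) ∧ y₁ ∈ Set.Icc (-(M / 2)) (M / 2) ∧
        x₂ ∈ Set.Icc (-(M / 2)) (M / 2) ∧ y₂ ∈ Set.Icc (-(M / 2)) (M / 2) ∧
        x₁ * y₂ ≠ x₂ * y₁ ∧
        q = ((x₁ + α * y₁) ^ 2 + (x₂ + α * y₂) ^ 2) / (x₁ * y₂ - x₂ * y₁) ^ 2}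
      (2 * α ^ 2 / M ^ 2) ∧
    ((-(M / 2) + α * (M / 2)) ^ 2 + (-(M / 2) + α * (M * (2 - α) / (2 * α))) ^ 2) /
        (-(M / 2) * (M * (2 - α) / (2 * α)) - -(M / 2) * (M / 2)) ^ 2 =
      2 * α ^ 2 / M ^ 2 := by
  have hα₀ : 0 < α := by linarith
  have attained : ((-(M / 2) + α * (M / 2)) ^ 2 + (-(M / 2) + α * (M * (2 - α) / (2 * α))) ^ 2) /
      (-(M / 2) * (M * (2 - α) / (2 * α)) - -(M / 2) * (M / 2)) ^ 2 = 2 * α ^ 2 / M ^ 2 := by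
    have hv : -(M / 2) + α * (M * (2 - α) / (2 * α)) = M * (1 - α) / 2 := by
      field_simp
      ring
    have hD : -(M / 2) * (M * (2 - α) / (2 * α)) - -(M / 2) * (M / 2) =
        M ^ 2 * (α - 1) / (2 * α) := by
      field_simp
      ring
    have hα₁ : α - 1 ≠ 0 := by linarith
    rw [hv, hD]
    field_simp
    ring
  refine ⟨⟨⟨-(M / 2), M / 2, -(M / 2), M * (2 - α) / (2 * α), ⟨by linarith, by linarith⟩,
    ⟨by linarith, by linarith⟩, ⟨by linarith, by linarith⟩, ⟨?_, ?_⟩, ?_, attained.symm⟩, ?_⟩,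
    attained⟩
  · rw [le_div_iff₀ (by positivity)]
    nlinarith
  · rw [div_le_iff₀ (by positivity)]
    nlinarith
  · intro h
    rw [h, sub_self, zero_pow two_ne_zero, div_zero] at attained
    have : 0 < 2 * α ^ 2 / M ^ 2 := by positivity
    linarith
  · rintro q ⟨x₁, y₁, x₂, y₂, hx₁, -, hx₂, -, hD, rfl⟩
    have hD' : 0 < (x₁ * y₂ - x₂ * y₁) ^ 2 := sq_pos_of_ne_zero (sub_ne_zero.mpr hD)
    have hx₁' : x₁ ^ 2 ≤ (M / 2) ^ 2 := sq_le_sq' hx₁.1 hx₁.2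
    have hx₂' : x₂ ^ 2 ≤ (M / 2) ^ 2 := sq_le_sq' hx₂.1 hx₂.2
    rw [div_le_div_iff₀ (by positivity) hD']
    have cauchy_schwarz : α ^ 2 * (x₁ * y₂ - x₂ * y₁) ^ 2 ≤
        ((x₁ + α * y₁) ^ 2 + (x₂ + α * y₂) ^ 2) * (x₁ ^ 2 + x₂ ^ 2) := by
      linarith [sq_nonneg (x₁ * (x₁ + α * y₁) + x₂ * (x₂ + α * y₂))]
    have bound : ((x₁ + α * y₁) ^ 2 + (x₂ + α * y₂) ^ 2) * (x₁ ^ 2 + x₂ ^ 2) ≤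
        ((x₁ + α * y₁) ^ 2 + (x₂ + α * y₂) ^ 2) * (M ^ 2 / 2) :=
      mul_le_mul_of_nonneg_left (by linarith) (by positivity)
    linarith
end

section
/- Let M > 2 be a real number and define D(M, α) = (M − 2)(3M − 2)(M² − 2M + 2)·α² − 2M(3M³ − 10M² + 12M − 4)·α + M²(3M² − 6M + 2). Then there exist real numbers α₁ and α₂ with α₁ < M/(M − 1) < α₂ such that D(M, α₁) = 0 and D(M, α₂) = 0. -/
def D (M α : ℝ) : ℝ :=
  (M - 2) * (3 * M - 2) * (M ^ 2 - 2 * M + 2) * α ^ 2 -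
    2 * M * (3 * M ^ 3 - 10 * M ^ 2 + 12 * M - 4) * α +
    M ^ 2 * (3 * M ^ 2 - 6 * M + 2)

/-- A real quadratic with positive leading coefficient that is negative at `x` has a root on each
side of `x`. -/
theorem exists_roots_straddling_of_quadratic_neg {a b c x : ℝ} (ha : 0 < a)
    (hx : a * x ^ 2 + b * x + c < 0) :
    ∃ y z : ℝ, y < x ∧ x < z ∧ a * y ^ 2 + b * y + c = 0 ∧ a * z ^ 2 + b * z + c = 0 := by
  have hlt : (2 * a * x + b) ^ 2 < discrim a b c := by
    unfold discrim
    nlinarith [mul_neg_of_pos_of_neg ha hx]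
  have hs : discrim a b c = √(discrim a b c) * √(discrim a b c) :=
    (Real.mul_self_sqrt ((sq_nonneg _).trans hlt.le)).symm
  obtain ⟨h₁, h₂⟩ := abs_lt.mp (Real.lt_sqrt_of_sq_lt ((sq_abs (2 * a * x + b)).trans_lt hlt))
  have root := fun t : ℝ => quadratic_eq_zero_iff ha.ne' hs t
  refine ⟨(-b - √(discrim a b c)) / (2 * a), (-b + √(discrim a b c)) / (2 * a), ?_, ?_, ?_, ?_⟩
  · rw [div_lt_iff₀ (by positivity)]
    linarith
  · rw [lt_div_iff₀ (by positivity)]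
    linarith
  · rw [pow_two]
    exact (root _).mpr (Or.inr rfl)
  · rw [pow_two]
    exact (root _).mpr (Or.inl rfl)

theorem D_div_sub_one {M : ℝ} (hM : M ≠ 1) :
    D M (M / (M - 1)) = (-M ^ 2 - 2 * M + 2) * (M / (M - 1)) ^ 2 := by
  have : M - 1 ≠ 0 := sub_ne_zero.mpr hM
  unfold D
  field_simp
  ring

theorem stmt_16 (M : ℝ) (hM : 2 < M) :
    ∃ α₁ α₂ : ℝ, α₁ < M / (M - 1) ∧ M / (M - 1) < α₂ ∧ D M α₁ = 0 ∧ D M α₂ = 0 := by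
  have ha : 0 < (M - 2) * (3 * M - 2) * (M ^ 2 - 2 * M + 2) :=
    mul_pos (mul_pos (by linarith) (by linarith)) (by nlinarith)
  have hneg : D M (M / (M - 1)) < 0 := by
    rw [D_div_sub_one (by linarith)]
    have : 0 < M / (M - 1) := div_pos (by linarith) (by linarith)
    exact mul_neg_of_neg_of_pos (by nlinarith) (by positivity)
  have hD : ∀ α, D M α = (M - 2) * (3 * M - 2) * (M ^ 2 - 2 * M + 2) * α ^ 2 +
      -(2 * M * (3 * M ^ 3 - 10 * M ^ 2 + 12 * M - 4)) * α +
      M ^ 2 * (3 * M ^ 2 - 6 * M + 2) := fun α => by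
    unfold D
    ring
  simp only [hD] at hneg ⊢
  exact exists_roots_straddling_of_quadratic_neg ha hneg
end
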